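/- Let n ≥ 1, let t ∈ ℝ with t ≠ 0, and let u be a Schwartz function on ℝⁿ. Then for every multi-index α, ∂^α u = ∑_{β ≤ α} ( α! / ( β! (α−β)! ) ) (1/(2it))^{|α−β|} ( J^{α−β} u ) · ∑_{γ : 2γ ≤ β} ( β! / ( γ! (β−2γ)! ) ) (i/(4t))^{|β−γ|} (2x)^{β−2γ}, where the outer sum is over multi-indices β with β ≤ α componentwise and the inner sum is over multi-indices γ with 2γ_j ≤ β_j for every j. -/

import Mathlib

open Finset
open scoped Nat

noncomputable section

abbrev Euc (n : ℕ) := EuclideanSpace ℝ (Fin n)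

/-- Length `|α|` of a multi-index. -/
def deg {n : ℕ} (α : Fin n → ℕ) : ℕ := ∑ i, α i

/-- Factorial `α!` of a multi-index. -/
def mfact {n : ℕ} (α : Fin n → ℕ) : ℕ := ∏ i, (α i)!

/-- First-order partial derivative in the `j`-th coordinate direction. -/
def pd {n : ℕ} (j : Fin n) (f : Euc n → ℂ) : Euc n → ℂ :=
  fun x => fderiv ℝ f x (EuclideanSpace.single j 1)

/-- Multi-index partial derivative `∂^α = ∂₁^{α₁} ⋯ ∂ₙ^{αₙ}`. -/
def pdM {n : ℕ} (α : Fin n → ℕ) (f : Euc n → ℂ) : Euc n → ℂ :=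
  ((List.ofFn fun j : Fin n => (pd j)^[α j]).foldr (· ∘ ·) id) f

/-- The operator `J_k = x_k + 2it∂_k`. -/
def Jop {n : ℕ} (t : ℝ) (k : Fin n) (f : Euc n → ℂ) : Euc n → ℂ :=
  fun x => (x k : ℂ) * f x + 2 * Complex.I * (t : ℂ) * pd k f x

/-- `J^α = J₁^{α₁} ⋯ Jₙ^{αₙ}`. -/
def JopM {n : ℕ} (t : ℝ) (α : Fin n → ℕ) (f : Euc n → ℂ) : Euc n → ℂ :=
  ((List.ofFn fun j : Fin n => (Jop t j)^[α j]).foldr (· ∘ ·) id) f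

end

open Polynomial in
/-- The polynomial `∑_{2γ ≤ k} k! / (γ! (k - 2γ)!) c^{k-γ} (2X)^{k-2γ}`, which is
`e^{-cx²} ∂^k e^{cx²}`. -/
noncomputable def gaussPoly (c : ℂ) (k : ℕ) : ℂ[X] :=
  ∑ γ ∈ range (k / 2 + 1),
    C ((k ! : ℂ) / ((γ ! : ℂ) * ((k - 2 * γ)! : ℂ)) * c ^ (k - γ)) * (2 * X) ^ (k - 2 * γ)

namespace GaussPoly

open Polynomial

/-- The summands of `gaussPoly`, extended by zero. -/
noncomputable def term (c : ℂ) (k γ : ℕ) : ℂ[X] :=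
  if 2 * γ ≤ k then
    C ((k ! : ℂ) / ((γ ! : ℂ) * ((k - 2 * γ)! : ℂ)) * c ^ (k - γ)) * (2 * X) ^ (k - 2 * γ)
  else 0

lemma eq_sum_term (c : ℂ) (k : ℕ) : gaussPoly c k = ∑ γ ∈ range (k + 1), term c k γ := by
  have hsub : range (k / 2 + 1) ⊆ range (k + 1) := by
    intro γ
    simp only [Finset.mem_range]
    omega
  unfold gaussPoly
  rw [← Finset.sum_subset hsub]
  · refine Finset.sum_congr rfl fun γ hγ => ?_
    rw [Finset.mem_range] at hγ
    rw [term, if_pos (by omega)]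
  · intro γ _ hγ
    rw [Finset.mem_range] at hγ
    rw [term, if_neg (by omega)]

lemma term_succ_zero (c : ℂ) (k : ℕ) : term c (k + 1) 0 = C (2 * c) * X * term c k 0 := by
  have h1 := Nat.cast_ne_zero (R := ℂ).2 (Nat.factorial_ne_zero k)
  have h2 := Nat.cast_ne_zero (R := ℂ).2 (Nat.factorial_ne_zero (k + 1))
  simp only [term, mul_zero, Nat.zero_le, if_true, Nat.sub_zero, Nat.factorial_zero, Nat.cast_one,
    one_mul, div_self h1, div_self h2, map_mul, map_pow, map_ofNat]
  ring

lemma derivative_term_of_eq (c : ℂ) (γ m : ℕ) :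
    derivative (term c (2 * γ + m) γ) =
      C (((2 * γ + m)! : ℂ) / ((γ ! : ℂ) * (m ! : ℂ)) * c ^ (γ + m) * (2 * m))
        * (2 * X) ^ (m - 1) := by
  rw [term, if_pos (by omega), show 2 * γ + m - 2 * γ = m by omega,
    show 2 * γ + m - γ = γ + m by omega, derivative_C_mul, derivative_pow]
  simp only [map_mul, map_pow, map_ofNat, map_natCast, derivative_mul, derivative_ofNat,
    derivative_X]
  ring

lemma term_succ_succ (c : ℂ) (k γ : ℕ) :
    term c (k + 1) (γ + 1) = C (2 * c) * X * term c k (γ + 1) + derivative (term c k γ) := by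
  have hγ := Nat.cast_ne_zero (R := ℂ).2 (Nat.factorial_ne_zero γ)
  have hγ' : (γ : ℂ) + 1 ≠ 0 := by exact_mod_cast Nat.succ_ne_zero γ
  rcases Nat.lt_or_ge k (2 * γ) with h | h
  · simp [term, show ¬ 2 * γ ≤ k by omega, show ¬ 2 * (γ + 1) ≤ k by omega,
      show ¬ 2 * (γ + 1) ≤ k + 1 by omega]
  obtain ⟨m, rfl⟩ := Nat.exists_eq_add_of_le h
  rw [derivative_term_of_eq]
  rcases m with _ | _ | m
  · simp [term, show ¬ 2 * (γ + 1) ≤ 2 * γ by omega, show ¬ 2 * (γ + 1) ≤ 2 * γ + 1 by omega]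
  · rw [term, term, if_pos (by omega), if_neg (by omega)]
    rw [show 2 * γ + (0 + 1) + 1 - 2 * (γ + 1) = 0 by omega,
      show 2 * γ + (0 + 1) + 1 - (γ + 1) = γ + (0 + 1) by omega]
    simp only [mul_zero, zero_add, Nat.sub_self, pow_zero, mul_one]
    congr 1
    rw [Nat.factorial_succ (2 * γ + 1), Nat.factorial_succ γ]
    push_cast
    simp only [Nat.factorial_zero, Nat.factorial_one, Nat.cast_one]
    field_simp
    ring
  · have hm := Nat.cast_ne_zero (R := ℂ).2 (Nat.factorial_ne_zero m)
    have hm1 : (m : ℂ) + 1 ≠ 0 := by exact_mod_cast Nat.succ_ne_zero m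
    have hm2 : (m : ℂ) + 1 + 1 ≠ 0 := by exact_mod_cast Nat.succ_ne_zero (m + 1)
    rw [term, term, if_pos (by omega), if_pos (by omega)]
    rw [show 2 * γ + (m + 1 + 1) + 1 - 2 * (γ + 1) = m + 1 by omega,
      show 2 * γ + (m + 1 + 1) + 1 - (γ + 1) = γ + m + 2 by omega,
      show 2 * γ + (m + 1 + 1) - 2 * (γ + 1) = m by omega,
      show 2 * γ + (m + 1 + 1) - (γ + 1) = γ + m + 1 by omega,
      show m + 1 + 1 - 1 = m + 1 by omega, show γ + (m + 1 + 1) = γ + m + 2 by omega]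
    have key (p : ℂ) : C (2 * c) * X * (C p * (2 * X) ^ m) = C (c * p) * (2 * X) ^ (m + 1) := by
      simp only [map_mul, map_ofNat]
      ring
    rw [key, ← add_mul, ← map_add]
    congr 2
    rw [Nat.factorial_succ (2 * γ + (m + 1 + 1)), Nat.factorial_succ γ, Nat.factorial_succ (m + 1),
      Nat.factorial_succ m]
    push_cast
    field_simp
    ring

end GaussPoly

open Polynomial in
lemma gaussPoly_zero (c : ℂ) : gaussPoly c 0 = 1 := by
  simp [gaussPoly]

open Polynomial GaussPoly in
lemma gaussPoly_succ (c : ℂ) (k : ℕ) :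
    gaussPoly c (k + 1) = C (2 * c) * X * gaussPoly c k + derivative (gaussPoly c k) := by
  have htop : term c k (k + 1) = 0 := by rw [term, if_neg (by omega)]
  have hsum : ∑ γ ∈ range (k + 1), term c k γ = ∑ γ ∈ range (k + 1 + 1), term c k γ := by
    rw [Finset.sum_range_succ _ (k + 1), htop, add_zero]
  rw [eq_sum_term, eq_sum_term, derivative_sum, Finset.sum_range_succ' _ (k + 1)]
  nth_rewrite 1 [hsum]
  rw [Finset.sum_range_succ' _ (k + 1), mul_add, Finset.mul_sum, term_succ_zero]
  simp only [term_succ_succ, Finset.sum_add_distrib]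
  ring

lemma gaussPoly_eval (c : ℂ) (k : ℕ) (x : ℂ) :
    (gaussPoly c k).eval x = ∑ γ ∈ range (k / 2 + 1),
      (k ! : ℂ) / ((γ ! : ℂ) * ((k - 2 * γ)! : ℂ)) * c ^ (k - γ) * (2 * x) ^ (k - 2 * γ) := by
  simp [gaussPoly, Polynomial.eval_finsetSum]

section Derivation

variable {S : Type*} [CommRing S] [Algebra ℂ S]

/-- If `D = a J + 2 c x` for a derivation `D` with `D x = 1`, then the powers of `D` expand in
those of `J`, with coefficients multiplication by `gaussPoly c b` evaluated at `x`. -/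
lemma Derivation.pow_eq_sum_gaussPoly (D : Derivation ℂ S S) (J : Module.End ℂ S) (x : S)
    (hx : D x = 1) (a c : ℂ) (hD : ∀ f, D f = a • J f + (2 * c) • (x * f)) (k : ℕ) :
    (D : Module.End ℂ S) ^ k = ∑ b ∈ range (k + 1),
      Algebra.lmul ℂ S (Polynomial.aeval x (gaussPoly c b)) *
        (k.choose b • (a • J) ^ (k - b)) := by
  have hstep (i j : ℕ) :
      (D : Module.End ℂ S) *
          (Algebra.lmul ℂ S (Polynomial.aeval x (gaussPoly c i)) * (a • J) ^ j) =
        Algebra.lmul ℂ S (Polynomial.aeval x (gaussPoly c i)) * (a • J) ^ (j + 1) +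
          Algebra.lmul ℂ S (Polynomial.aeval x (gaussPoly c (i + 1))) * (a • J) ^ j := by
    rw [pow_succ' _ j]
    ext f
    simp only [LinearMap.add_apply, Module.End.mul_apply]
    generalize ((a • J) ^ j) f = g
    simp only [Derivation.coeFn_coe, Algebra.coe_lmul_eq_mul, LinearMap.mul_apply', D.leibniz,
      D.map_aeval, hx, hD g, LinearMap.smul_apply]
    simp only [gaussPoly_succ, map_add, map_mul, Polynomial.aeval_X, Polynomial.aeval_C,
      smul_eq_mul, Algebra.smul_def]
    ring
  have hanti : (D : Module.End ℂ S) ^ k = ∑ ij ∈ antidiagonal k, k.choose ij.1 •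
      (Algebra.lmul ℂ S (Polynomial.aeval x (gaussPoly c ij.1)) * (a • J) ^ ij.2) := by
    induction k with
    | zero =>
      simp only [gaussPoly_zero, map_one, Finset.Nat.antidiagonal_zero, Finset.sum_singleton]
      simp
    | succ k ih =>
      rw [Finset.sum_antidiagonal_choose_succ_nsmul
        (fun i j => Algebra.lmul ℂ S (Polynomial.aeval x (gaussPoly c i)) * (a • J) ^ j),
        pow_succ', ih, Finset.mul_sum, ← Finset.sum_add_distrib]
      refine Finset.sum_congr rfl fun ij hij => ?_
      rw [mul_smul_comm, hstep, smul_add, Nat.choose_symm_of_eq_add (mem_antidiagonal.1 hij).symm]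
  rw [hanti, Finset.Nat.sum_antidiagonal_eq_sum_range_succ_mk]
  simp only [mul_smul_comm]

end Derivation

/-- Distributivity of an ordered product of sums of products, when factors with different indices
commute. -/
lemma List.prod_ofFn_sum_mul {R : Type*} [Semiring R] {n : ℕ} (s : Fin n → Finset ℕ)
    (P Q : Fin n → ℕ → R) (hPQ : ∀ i j, i ≠ j → ∀ b b', Commute (P i b) (Q j b')) :
    (List.ofFn fun j => ∑ b ∈ s j, P j b * Q j b).prod =
      ∑ β ∈ Fintype.piFinset s, (List.ofFn fun j => P j (β j)).prod *
        (List.ofFn fun j => Q j (β j)).prod := by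
  induction n with
  | zero => simp
  | succ n ih =>
    have hbij : ∑ β ∈ Fintype.piFinset s, (List.ofFn fun j => P j (β j)).prod *
        (List.ofFn fun j => Q j (β j)).prod =
        ∑ p ∈ s 0 ×ˢ Fintype.piFinset (fun j : Fin n => s j.succ),
          (P 0 p.1 * (List.ofFn fun j : Fin n => P j.succ (p.2 j)).prod) *
            (Q 0 p.1 * (List.ofFn fun j : Fin n => Q j.succ (p.2 j)).prod) := by
      refine Finset.sum_nbij' (fun β => (β 0, fun j => β j.succ)) (fun p => Fin.cons p.1 p.2)
        ?_ ?_ ?_ ?_ ?_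
      · intro β hβ
        simp only [Fintype.mem_piFinset, Finset.mem_product] at hβ ⊢
        exact ⟨hβ 0, fun j => hβ j.succ⟩
      · intro p hp
        simp only [Fintype.mem_piFinset, Finset.mem_product] at hp ⊢
        exact Fin.cases hp.1 hp.2
      · intro β _
        exact Fin.cons_self_tail β
      · intro p _
        simp
      · intro β _
        simp [List.ofFn_succ]
    rw [hbij, Finset.sum_product, List.ofFn_succ, List.prod_cons,
      ih _ _ _ (fun i j hij => hPQ _ _ (by simpa using hij)), Finset.sum_mul_sum]
    refine Finset.sum_congr rfl fun b _ => Finset.sum_congr rfl fun β _ => ?_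
    have hcomm : Commute (List.ofFn fun j : Fin n => P j.succ (β j)).prod (Q 0 b) := by
      refine Commute.list_prod_left _ _ fun y hy => ?_
      obtain ⟨j, rfl⟩ := List.mem_ofFn.1 hy
      exact hPQ _ _ (Fin.succ_ne_zero j) _ _
    simp only [mul_assoc]
    rw [← mul_assoc (Q 0 b), ← hcomm.eq, mul_assoc]

open scoped ContDiff in
/-- The algebra of smooth complex-valued functions on `ℝⁿ`. -/
noncomputable def smoothFun (n : ℕ) : Subalgebra ℂ (Euc n → ℂ) where
  carrier := {f | ContDiff ℝ ∞ f}
  mul_mem' {f g} (hf : ContDiff ℝ ∞ f) (hg : ContDiff ℝ ∞ g) := hf.mul hg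
  add_mem' {f g} (hf : ContDiff ℝ ∞ f) (hg : ContDiff ℝ ∞ g) := hf.add hg
  algebraMap_mem' r := (contDiff_const : ContDiff ℝ ∞ fun _ : Euc n => r)

namespace smoothFun

variable {n : ℕ}

open scoped ContDiff in
lemma contDiff (f : smoothFun n) : ContDiff ℝ ∞ (f : Euc n → ℂ) := f.2

lemma differentiableAt (f : smoothFun n) (x : Euc n) : DifferentiableAt ℝ (f : Euc n → ℂ) x :=
  ((contDiff f).differentiable (by simp)).differentiableAt

/-- Partial differentiation as a derivation of the algebra of smooth functions. -/
noncomputable def deriv (j : Fin n) : Derivation ℂ (smoothFun n) (smoothFun n) :=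
  Derivation.mk'
    { toFun := fun f => ⟨pd j f,
        ((contDiff f).fderiv_right (m := (⊤ : ℕ∞)) (by simp)).clm_apply contDiff_const⟩
      map_add' := fun f g => by
        ext x
        simp [pd, fderiv_add (differentiableAt f x) (differentiableAt g x)]
      map_smul' := fun r f => by
        ext x
        simp [pd, fderiv_const_smul (differentiableAt f x)] }
    (fun f g => by
      ext x
      simp [pd, fderiv_mul (differentiableAt f x) (differentiableAt g x)])

/-- The `j`-th coordinate function. -/
noncomputable def coord (j : Fin n) : smoothFun n :=
  ⟨fun x => (x j : ℂ), (Complex.ofRealCLM.comp (EuclideanSpace.proj (𝕜 := ℝ) j)).contDiff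
    (n := (⊤ : ℕ∞))⟩

@[simp] lemma coe_coord (j : Fin n) (x : Euc n) : (coord j : Euc n → ℂ) x = x j := rfl

lemma deriv_coord (j k : Fin n) : deriv j (coord k) = if k = j then 1 else 0 := by
  ext x
  have h : HasFDerivAt (fun x : Euc n => (x k : ℂ))
      (Complex.ofRealCLM.comp (EuclideanSpace.proj (𝕜 := ℝ) k)) x :=
    (Complex.ofRealCLM.comp (EuclideanSpace.proj (𝕜 := ℝ) k)).hasFDerivAt
  change fderiv ℝ (fun x : Euc n => (x k : ℂ)) x _ = _
  rw [h.fderiv]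
  split_ifs with hkj <;> simp [hkj]

/-- The operator `Jop` on smooth functions. -/
noncomputable def J (t : ℝ) (j : Fin n) : Module.End ℂ (smoothFun n) :=
  Algebra.lmul ℂ _ (coord j) + (2 * Complex.I * (t : ℂ)) • (deriv j : Module.End ℂ (smoothFun n))

lemma J_apply (t : ℝ) (j : Fin n) (f : smoothFun n) :
    J t j f = coord j * f + (2 * Complex.I * (t : ℂ)) • deriv j f := rfl

lemma coe_J (t : ℝ) (j : Fin n) (f : smoothFun n) :
    (J t j f : Euc n → ℂ) = Jop t j f := rfl

lemma coe_prod_ofFn_pow {m : ℕ} (L : Fin m → Module.End ℂ (smoothFun n))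
    (F : Fin m → (Euc n → ℂ) → Euc n → ℂ) (hLF : ∀ j f, (L j f : Euc n → ℂ) = F j f)
    (α : Fin m → ℕ) (f : smoothFun n) :
    ((List.ofFn fun j => L j ^ α j).prod f : Euc n → ℂ) =
      ((List.ofFn fun j => (F j)^[α j]).foldr (· ∘ ·) id) f := by
  induction m with
  | zero => simp
  | succ m ih =>
    have hpow (k : ℕ) (j) (g : smoothFun n) :
        ((L j ^ k) g : Euc n → ℂ) = (F j)^[k] g := by
      induction k with
      | zero => simp
      | succ k ihk => rw [pow_succ', Module.End.mul_apply, hLF, ihk, Function.iterate_succ_apply']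
    rw [List.ofFn_succ, List.prod_cons, Module.End.mul_apply, hpow,
      ih _ _ (fun j => hLF j.succ), List.ofFn_succ, List.foldr_cons, Function.comp_apply]

lemma commute_lmul_J (t : ℝ) {i j : Fin n} (hij : i ≠ j) (p : Polynomial ℂ) :
    Commute (Algebra.lmul ℂ _ (Polynomial.aeval (coord i) p)) (J t j) := by
  ext1 f
  have h : deriv j (Polynomial.aeval (coord i) p) = 0 := by
    rw [Derivation.map_aeval, deriv_coord, if_neg hij, smul_zero]
  simp only [Module.End.mul_apply, J_apply, Algebra.coe_lmul_eq_mul, LinearMap.mul_apply',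
    Derivation.leibniz, h, mul_zero, add_zero, smul_eq_mul, mul_add, mul_smul_comm]
  congr 1
  ring

lemma deriv_eq (t : ℝ) (ht : t ≠ 0) (j : Fin n) (f : smoothFun n) :
    deriv j f = (1 / (2 * Complex.I * (t : ℂ))) • J t j f +
      (2 * (Complex.I / (4 * (t : ℂ)))) • (coord j * f) := by
  have ht' : (t : ℂ) ≠ 0 := by exact_mod_cast ht
  have h1 : 1 / (2 * Complex.I * (t : ℂ)) * (2 * Complex.I * (t : ℂ)) = 1 := by
    field_simp [Complex.I_ne_zero]
  have h2 : 1 / (2 * Complex.I * (t : ℂ)) + 2 * (Complex.I / (4 * (t : ℂ))) = 0 := by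
    field_simp [Complex.I_ne_zero]
    rw [Complex.I_sq]
    ring
  rw [J_apply, smul_add, smul_smul, h1, one_smul, add_right_comm, ← add_smul, h2, zero_smul,
    zero_add]

lemma coe_aeval_coord (j : Fin n) (p : Polynomial ℂ) (x : Euc n) :
    (Polynomial.aeval (coord j) p : smoothFun n).1 x = p.eval (x j : ℂ) := by
  induction p using Polynomial.induction_on' with
  | add p q hp hq => simp_all
  | monomial k a => simp [Polynomial.aeval_monomial, Algebra.algebraMap_eq_smul_one]

/-- Expansion of `∂^α` in powers of the `J_k` on smooth functions. -/
lemma prod_deriv_pow (t : ℝ) (ht : t ≠ 0) (α : Fin n → ℕ) :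
    (List.ofFn fun j => (deriv j : Module.End ℂ (smoothFun n)) ^ α j).prod =
      ∑ β ∈ Fintype.piFinset (fun i => range (α i + 1)),
        (List.ofFn fun j => Algebra.lmul ℂ (smoothFun n)
          (Polynomial.aeval (coord j) (gaussPoly (Complex.I / (4 * (t : ℂ))) (β j)))).prod *
        (List.ofFn fun j => (α j).choose (β j) •
          ((1 / (2 * Complex.I * (t : ℂ))) • J t j) ^ (α j - β j)).prod := by
  rw [← List.prod_ofFn_sum_mul (fun i => range (α i + 1)) (fun j b => Algebra.lmul ℂ (smoothFun n)
      (Polynomial.aeval (coord j) (gaussPoly (Complex.I / (4 * (t : ℂ))) b)))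
    (fun j b => (α j).choose b • ((1 / (2 * Complex.I * (t : ℂ))) • J t j) ^ (α j - b))
    (fun i j hij b b' => (((commute_lmul_J t hij _).smul_right _).pow_right _).smul_right _)]
  congr 2
  ext1 j
  exact Derivation.pow_eq_sum_gaussPoly (deriv j) (J t j) (coord j) (by simp [deriv_coord]) _ _
    (deriv_eq t ht j) (α j)

end smoothFun

lemma List.prod_ofFn_smul {R : Type*} [Semiring R] [Algebra ℂ R] {n : ℕ} (r : Fin n → ℂ)
    (L : Fin n → R) :
    (List.ofFn fun j => r j • L j).prod = (∏ j, r j) • (List.ofFn L).prod := by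
  induction n with
  | zero => simp
  | succ n ih =>
    rw [List.ofFn_succ, List.prod_cons, ih, List.ofFn_succ, List.prod_cons, Fin.prod_univ_succ,
      smul_mul_smul_comm]

lemma prod_gaussPoly_eval {n : ℕ} (c : ℂ) (β : Fin n → ℕ) (x : Fin n → ℂ) :
    ∏ i, (gaussPoly c (β i)).eval (x i) =
      ∑ γ ∈ Fintype.piFinset (fun i => range (β i / 2 + 1)),
        (mfact β : ℂ) / ((mfact γ : ℂ) * (mfact (fun i => β i - 2 * γ i) : ℂ)) *
          c ^ (deg β - deg γ) * ∏ i, (2 * x i) ^ (β i - 2 * γ i) := by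
  simp only [gaussPoly_eval]
  rw [Finset.prod_univ_sum]
  refine Finset.sum_congr rfl fun γ hγ => ?_
  have hle (i : Fin n) : γ i ≤ β i := by
    have := Finset.mem_range.1 (Fintype.mem_piFinset.1 hγ i)
    omega
  have hdeg : deg β - deg γ = ∑ i, (β i - γ i) :=
    (Finset.sum_tsub_distrib _ fun i _ => hle i).symm
  rw [hdeg, ← Finset.prod_pow_eq_pow_sum]
  simp only [mfact, Nat.cast_prod, Finset.prod_mul_distrib, Finset.prod_div_distrib]

/-- Hermite expansion of `∂^α u` in terms of `J^{α−β} u`.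
For `t ≠ 0` and `u` Schwartz,
`∂^α u = ∑_{β≤α} α!/(β!(α−β)!) (1/(2it))^{|α−β|} (J^{α−β}u) ·
  ∑_{2γ≤β} β!/(γ!(β−2γ)!) (i/(4t))^{|β−γ|} (2x)^{β−2γ}`. -/
theorem statement14 (n : ℕ) (hn : 1 ≤ n) (t : ℝ) (ht : t ≠ 0)
    (u : SchwartzMap (Euc n) ℂ) (α : Fin n → ℕ) :
    pdM α ⇑u = fun x =>
      ∑ β ∈ Fintype.piFinset (fun i => Finset.range (α i + 1)),
        (mfact α : ℂ) / ((mfact β : ℂ) * (mfact (fun i => α i - β i) : ℂ)) *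
          (1 / (2 * Complex.I * (t : ℂ))) ^ (deg (fun i => α i - β i)) *
          JopM t (fun i => α i - β i) (⇑u) x *
          ∑ γ ∈ Fintype.piFinset (fun i => Finset.range (β i / 2 + 1)),
            (mfact β : ℂ) / ((mfact γ : ℂ) * (mfact (fun i => β i - 2 * γ i) : ℂ)) *
              (Complex.I / (4 * (t : ℂ))) ^ (deg β - deg γ) *
              ∏ i, (2 * (x i : ℂ)) ^ (β i - 2 * γ i) := by
  have hsmooth : (u : Euc n → ℂ) ∈ smoothFun n := u.smooth _
  let f : smoothFun n := ⟨u, hsmooth⟩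
  have hpd : pdM α ⇑u = _ :=
    (smoothFun.coe_prod_ofFn_pow (fun j => (smoothFun.deriv j : Module.End ℂ (smoothFun n))) pd
      (fun _ _ => rfl) α f).symm
  rw [hpd, smoothFun.prod_deriv_pow t ht]
  ext x
  rw [LinearMap.sum_apply, AddSubmonoidClass.coe_finsetSum, Finset.sum_apply]
  refine Finset.sum_congr rfl fun β hβ => ?_
  have hle (i : Fin n) : β i ≤ α i :=
    Nat.lt_succ_iff.1 (Finset.mem_range.1 (Fintype.mem_piFinset.1 hβ i))
  have hJ : ((List.ofFn fun j => smoothFun.J t j ^ (α j - β j)).prod f : Euc n → ℂ) =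
      JopM t (fun i => α i - β i) u :=
    smoothFun.coe_prod_ofFn_pow (smoothFun.J t) (Jop t) (smoothFun.coe_J t) _ f
  have hlmul : (List.ofFn fun j => Algebra.lmul ℂ (smoothFun n) (Polynomial.aeval
      (smoothFun.coord j) (gaussPoly (Complex.I / (4 * (t : ℂ))) (β j)))).prod =
      Algebra.lmul ℂ (smoothFun n) (∏ j, Polynomial.aeval
        (smoothFun.coord j) (gaussPoly (Complex.I / (4 * (t : ℂ))) (β j))) := by
    rw [← List.prod_ofFn, map_list_prod, List.map_ofFn]
    rfl
  have hcoef : ∏ j, (((α j).choose (β j) : ℂ) * (1 / (2 * Complex.I * (t : ℂ))) ^ (α j - β j)) =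
      (mfact α : ℂ) / ((mfact β : ℂ) * (mfact (fun i => α i - β i) : ℂ)) *
        (1 / (2 * Complex.I * (t : ℂ))) ^ (deg (fun i => α i - β i)) := by
    simp only [Nat.cast_choose ℂ (hle _), mfact, deg, Nat.cast_prod, Finset.prod_mul_distrib,
      Finset.prod_div_distrib, Finset.prod_pow_eq_pow_sum]
  simp only [smul_pow, ← Nat.cast_smul_eq_nsmul ℂ, smul_smul]
  rw [List.prod_ofFn_smul, hlmul, hcoef, ← prod_gaussPoly_eval, ← hJ]
  simp only [Module.End.mul_apply, LinearMap.smul_apply, Algebra.coe_lmul_eq_mul,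
    LinearMap.mul_apply', ← smoothFun.coe_aeval_coord]
  simp [Finset.prod_apply]
  ring
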